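/- Let d ∈ {1, 2} and β > 0. There exists an integer N₀ depending only on β and d such that for all N ≥ N₀ the kernel K_{N,β}(x) = ∑_{k ∈ ℤ^d, |k|_∞ ≤ N} (1 + 4π²β|k|²)^{-1} e^{2πi k·x} is strictly positive at every point of 𝕋^d and satisfies ∫_{𝕋^d} K_{N,β}(x) dx = 1; consequently ‖T_{N,β} f‖_{L^∞(𝕋^d)} ≤ ‖f‖_{L^∞(𝕋^d)} for every f ∈ L^∞(𝕋^d). -/

import Mathlib

open MeasureTheory

noncomputable section

/-- The fundamental domain `[0,1)^d` of the torus `𝕋^d = (ℝ/ℤ)^d`. -/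
def torusBox (d : ℕ) : Set (Fin d → ℝ) :=
  Set.univ.pi fun _ => Set.Ico (0 : ℝ) 1

/-- The character `e^{2πi k·x}` on `𝕋^d`. -/
def torusChar (d : ℕ) (k : Fin d → ℤ) (x : Fin d → ℝ) : ℂ :=
  Complex.exp (2 * Real.pi * Complex.I * (∑ i, (k i : ℝ) * x i))

/-- The kernel `K_{N,β}(x) = ∑_{|k|_∞ ≤ N} (1 + 4π²β|k|²)⁻¹ e^{2πik·x}` of the operator
`T_{N,β} = (Id − βΔ)⁻¹ Π_N`. -/
def KNbeta (d : ℕ) (β : ℝ) (N : ℕ) (x : Fin d → ℝ) : ℂ :=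
  ∑ k ∈ Fintype.piFinset (fun _ : Fin d => Finset.Icc (-(N : ℤ)) (N : ℤ)),
    (((1 + 4 * Real.pi ^ 2 * β * ∑ i, ((k i : ℝ)) ^ 2)⁻¹ : ℝ) : ℂ) * torusChar d k x

/-- The operator `(T_{N,β} f)(x) = ∑_{|k|_∞ ≤ N} (1 + 4π²β|k|²)⁻¹ f̂(k) e^{2πik·x}`. -/
def TNbeta (d : ℕ) (β : ℝ) (N : ℕ) (f : (Fin d → ℝ) → ℂ) (x : Fin d → ℝ) : ℂ :=
  ∑ k ∈ Fintype.piFinset (fun _ : Fin d => Finset.Icc (-(N : ℤ)) (N : ℤ)),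
    (((1 + 4 * Real.pi ^ 2 * β * ∑ i, ((k i : ℝ)) ^ 2)⁻¹ : ℝ) : ℂ) *
      (∫ y in torusBox d, f y * torusChar d (fun i => -(k i)) y) * torusChar d k x

/-- The one-dimensional theta series `∑_{|n| ≤ N} e^{-s n²} e^{2πi n x}`, in cosine form. -/
def truncTheta (N : ℕ) (s x : ℝ) : ℝ :=
  1 + ∑ n ∈ Finset.range N,
    2 * Real.cos (2 * Real.pi * x * (n + 1)) * Real.exp (-(s * (n + 1) ^ 2))

/-- The full one-dimensional theta series `∑_n e^{-s n²} e^{2πi n x}`, in cosine form. -/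
def fullTheta (s x : ℝ) : ℝ :=
  1 + ∑' n : ℕ, 2 * Real.cos (2 * Real.pi * x * (n + 1)) * Real.exp (-(s * (n + 1) ^ 2))

lemma hasSum_fullTheta {s : ℝ} (hs : 0 < s) (x : ℝ) :
    HasSum (fun n : ℕ => 2 * Real.cos (2 * Real.pi * x * (n + 1)) *
      Real.exp (-(s * (n + 1) ^ 2))) (HurwitzZeta.cosKernel x (s / Real.pi) - 1) := by
  convert HurwitzZeta.hasSum_nat_cosKernel₀ x (div_pos hs Real.pi_pos) using 5 with n
  field_simp

lemma fullTheta_eq_cosKernel {s : ℝ} (hs : 0 < s) (x : ℝ) :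
    fullTheta s x = HurwitzZeta.cosKernel x (s / Real.pi) := by
  rw [fullTheta, (hasSum_fullTheta hs x).tsum_eq]
  ring

/-- Positivity of the theta series, a consequence of Poisson summation. -/
lemma fullTheta_nonneg {s : ℝ} (hs : 0 < s) (x : ℝ) : 0 ≤ fullTheta s x := by
  rw [fullTheta_eq_cosKernel hs]
  set t := s / Real.pi with ht_def
  have ht : 0 < t := div_pos hs Real.pi_pos
  have h := HurwitzZeta.evenKernel_functional_equation (x : UnitAddCircle) (1 / t)
  rw [one_div_one_div] at h
  have h0 : 0 ≤ HurwitzZeta.evenKernel (x : UnitAddCircle) (1 / t) :=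
    (HurwitzZeta.hasSum_int_evenKernel x (one_div_pos.mpr ht)).nonneg fun _ => (Real.exp_pos _).le
  rw [h] at h0
  exact nonneg_of_mul_nonneg_right h0 (by positivity)

lemma summable_exp_neg_mul_sq {s : ℝ} (hs : 0 < s) :
    Summable fun n : ℕ => Real.exp (-(s * ((n : ℝ) + 1) ^ 2)) := by
  have h := (hasSum_fullTheta hs 0).summable.div_const 2
  refine h.congr fun n => ?_
  simp

lemma half_le_fullTheta {s : ℝ} (hs : 2 ≤ s) (x : ℝ) : 1 / 2 ≤ fullTheta s x := by
  have hs0 : 0 < s := by linarith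
  have he : Real.exp (-2) ≤ 1 / 7 := by
    rw [Real.exp_neg, ← one_div]
    refine one_div_le_one_div_of_le (by norm_num) ?_
    have h1 := Real.exp_one_gt_d9
    have h2 : Real.exp 2 = Real.exp 1 * Real.exp 1 := by rw [← Real.exp_add]; norm_num
    rw [h2]
    nlinarith
  have hgeo : HasSum (fun n : ℕ => 2 / 7 * (1 / 7 : ℝ) ^ n) (2 / 7 * (1 - 1 / 7)⁻¹) :=
    (hasSum_geometric_of_lt_one (by norm_num) (by norm_num)).mul_left _
  have hb : ∀ n : ℕ, ‖2 * Real.cos (2 * Real.pi * x * (n + 1)) *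
      Real.exp (-(s * (n + 1) ^ 2))‖ ≤ 2 / 7 * (1 / 7 : ℝ) ^ n := fun n => by
    rw [norm_mul, norm_mul, Real.norm_of_nonneg (Real.exp_pos _).le, Real.norm_eq_abs,
      Real.norm_eq_abs, abs_two]
    have h1 : Real.exp (-(s * ((n : ℝ) + 1) ^ 2)) ≤ Real.exp (-2) ^ (n + 1) := by
      rw [← Real.exp_nat_mul]
      refine Real.exp_le_exp.mpr ?_
      push_cast
      have hn : (0 : ℝ) ≤ n := n.cast_nonneg
      nlinarith [mul_nonneg hn hn, mul_nonneg (sub_nonneg.mpr hs) (sq_nonneg ((n : ℝ) + 1))]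
    have h2 : Real.exp (-2) ^ (n + 1) ≤ (1 / 7 : ℝ) ^ (n + 1) := by gcongr
    calc 2 * |Real.cos (2 * Real.pi * x * (n + 1))| * Real.exp (-(s * ((n : ℝ) + 1) ^ 2))
        ≤ 2 * 1 * (1 / 7 : ℝ) ^ (n + 1) := by
          gcongr
          · exact Real.abs_cos_le_one _
          · exact h1.trans h2
      _ = 2 / 7 * (1 / 7 : ℝ) ^ n := by ring
  have := tsum_of_norm_bounded hgeo hb
  rw [Real.norm_eq_abs, abs_le] at this
  have h := this.1
  norm_num at h
  rw [fullTheta]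
  linarith

lemma abs_fullTheta_sub_truncTheta_le_tsum {s : ℝ} (hs : 0 < s) (N : ℕ) (x : ℝ) :
    |fullTheta s x - truncTheta N s x| ≤
      2 * ∑' n : ℕ, Real.exp (-(s * (((n + N : ℕ) : ℝ) + 1) ^ 2)) := by
  have hsum := (hasSum_fullTheta hs x).summable
  rw [fullTheta, truncTheta, ← hsum.sum_add_tsum_nat_add N, add_sub_add_left_eq_sub,
    add_sub_cancel_left, ← tsum_mul_left, ← Real.norm_eq_abs]
  have h1 := ((summable_nat_add_iff N).mpr (summable_exp_neg_mul_sq hs)).mul_left 2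
  refine tsum_of_norm_bounded h1.hasSum fun n => ?_
  rw [norm_mul, norm_mul, Real.norm_of_nonneg (Real.exp_pos _).le, Real.norm_eq_abs,
    Real.norm_eq_abs, abs_two]
  have := Real.abs_cos_le_one (2 * Real.pi * x * (((n + N : ℕ) : ℝ) + 1))
  have := Real.exp_pos (-(s * (((n + N : ℕ) : ℝ) + 1) ^ 2))
  nlinarith

lemma abs_truncTheta_le {s : ℝ} (hs : 0 ≤ s) (N : ℕ) (x : ℝ) :
    |truncTheta N s x| ≤ 2 * N + 1 := by
  rw [truncTheta]
  refine (abs_add_le _ _).trans ?_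
  rw [abs_one, add_comm]
  gcongr
  refine (Finset.abs_sum_le_sum_abs _ _).trans ?_
  calc _ ≤ ∑ n ∈ Finset.range N, (2 : ℝ) := by
        refine Finset.sum_le_sum fun n _ => ?_
        rw [abs_mul, abs_mul, abs_two, Real.abs_exp]
        have h1 := Real.abs_cos_le_one (2 * Real.pi * x * ((n : ℝ) + 1))
        have h2 : Real.exp (-(s * ((n : ℝ) + 1) ^ 2)) ≤ 1 :=
          Real.exp_le_one_iff.mpr (neg_nonpos.mpr (by positivity))
        nlinarith [Real.exp_pos (-(s * ((n : ℝ) + 1) ^ 2)),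
          abs_nonneg (Real.cos (2 * Real.pi * x * ((n : ℝ) + 1)))]
    _ = 2 * N := by simp [mul_comm]

/-- Closed form of the Dirichlet kernel. -/
lemma dirichlet_mul_sin (n : ℕ) (x : ℝ) :
    (1 + ∑ i ∈ Finset.range n, 2 * Real.cos (2 * Real.pi * x * (i + 1))) * Real.sin (Real.pi * x) =
      Real.sin ((2 * n + 1) * (Real.pi * x)) := by
  induction n with
  | zero => simp
  | succ n ih =>
    rw [Finset.sum_range_succ, ← add_assoc, add_mul, ih]
    have h1 : (2 * (n : ℝ) + 1) * (Real.pi * x) =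
        2 * Real.pi * x * (n + 1) - Real.pi * x := by ring
    have h2 : (2 * ((n + 1 : ℕ) : ℝ) + 1) * (Real.pi * x) =
        2 * Real.pi * x * (n + 1) + Real.pi * x := by push_cast; ring
    rw [h1, h2, Real.sin_sub, Real.sin_add]
    ring

lemma abs_dirichlet_le {x : ℝ} (hx : Real.sin (Real.pi * x) ≠ 0) (n : ℕ) :
    |1 + ∑ i ∈ Finset.range n, 2 * Real.cos (2 * Real.pi * x * (i + 1))| ≤
      1 / |Real.sin (Real.pi * x)| := by
  rw [le_div_iff₀ (abs_pos.mpr hx), ← abs_mul, dirichlet_mul_sin]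
  exact Real.abs_sin_le_one _

/-- Abel summation for increments of a bounded sequence against antitone nonnegative weights. -/
lemma abs_sum_antitone_mul_le {a u D : ℕ → ℝ} {B : ℝ} (ha : Antitone a) (ha0 : ∀ n, 0 ≤ a n)
    (hD : ∀ n, |D n| ≤ B) (hu : ∀ n, D (n + 1) = D n + u n) (N L : ℕ) :
    |∑ n ∈ Finset.range L, u (n + N) * a (n + N + 1)| ≤ 2 * a N * B := by
  have key : ∀ L : ℕ, |(∑ n ∈ Finset.range L, u (n + N) * a (n + N + 1)) -
      a (L + N) * D (L + N)| ≤ (2 * a N - a (L + N)) * B := by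
    intro L
    induction L with
    | zero =>
      simp only [Finset.range_zero, Finset.sum_empty, zero_sub, abs_neg, zero_add, abs_mul,
        abs_of_nonneg (ha0 N)]
      have := mul_le_mul_of_nonneg_left (hD N) (ha0 N)
      linarith
    | succ L ih =>
      rw [Finset.sum_range_succ, show L + 1 + N = L + N + 1 by ring, hu (L + N)]
      have h : (∑ n ∈ Finset.range L, u (n + N) * a (n + N + 1)) +
          u (L + N) * a (L + N + 1) - a (L + N + 1) * (D (L + N) + u (L + N)) =
          ((∑ n ∈ Finset.range L, u (n + N) * a (n + N + 1)) - a (L + N) * D (L + N)) +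
          (a (L + N) - a (L + N + 1)) * D (L + N) := by ring
      rw [h]
      refine (abs_add_le _ _).trans ?_
      have hd : 0 ≤ a (L + N) - a (L + N + 1) := sub_nonneg.mpr (ha (Nat.le_succ _))
      rw [abs_mul (a (L + N) - a (L + N + 1)), abs_of_nonneg hd]
      have := mul_le_mul_of_nonneg_left (hD (L + N)) hd
      linarith
  have h1 := key L
  have h2 : |a (L + N) * D (L + N)| ≤ a (L + N) * B := by
    rw [abs_mul, abs_of_nonneg (ha0 _)]
    exact mul_le_mul_of_nonneg_left (hD _) (ha0 _)
  calc _ = |((∑ n ∈ Finset.range L, u (n + N) * a (n + N + 1)) - a (L + N) * D (L + N)) +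
        a (L + N) * D (L + N)| := by rw [sub_add_cancel]
    _ ≤ _ := abs_add_le _ _
    _ ≤ 2 * a N * B := by linarith

lemma abs_fullTheta_sub_truncTheta_le {s : ℝ} (hs : 0 < s) (N : ℕ) {x : ℝ}
    (hx : Real.sin (Real.pi * x) ≠ 0) :
    |fullTheta s x - truncTheta N s x| ≤
      2 * Real.exp (-(s * (N : ℝ) ^ 2)) * (1 / |Real.sin (Real.pi * x)|) := by
  have hsum := (hasSum_fullTheta hs x).summable
  rw [fullTheta, truncTheta, ← hsum.sum_add_tsum_nat_add N, add_sub_add_left_eq_sub,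
    add_sub_cancel_left]
  have ht := ((summable_nat_add_iff N).mpr hsum).hasSum.tendsto_sum_nat.abs
  refine le_of_tendsto' ht fun L => ?_
  have := abs_sum_antitone_mul_le (a := fun n : ℕ => Real.exp (-(s * (n : ℝ) ^ 2)))
    (u := fun n : ℕ => 2 * Real.cos (2 * Real.pi * x * (n + 1)))
    (D := fun n => 1 + ∑ i ∈ Finset.range n, 2 * Real.cos (2 * Real.pi * x * (i + 1)))
    (fun m n h => by dsimp only; gcongr) (fun n => (Real.exp_pos _).le) (abs_dirichlet_le hx)
    (fun n => by rw [Finset.sum_range_succ, add_assoc]) N L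
  simpa using this

lemma abs_fullTheta_le {s : ℝ} (hs : 0 < s) {x : ℝ} (hx : Real.sin (Real.pi * x) ≠ 0) :
    |fullTheta s x| ≤ 3 * (1 / |Real.sin (Real.pi * x)|) := by
  have h := abs_fullTheta_sub_truncTheta_le hs 0 hx
  have h1 : 1 ≤ 1 / |Real.sin (Real.pi * x)| := by
    rw [le_div_iff₀ (abs_pos.mpr hx), one_mul]
    exact Real.abs_sin_le_one _
  simp only [truncTheta, Finset.range_zero, Finset.sum_empty, add_zero, Nat.cast_zero] at h
  norm_num at h
  have h2 := abs_add_le (fullTheta s x - 1) 1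
  rw [sub_add_cancel, abs_one] at h2
  rw [one_div] at h1 ⊢
  linarith

/-- Pointwise lower bound for a product of truncated theta series away from the lattice. -/
lemma truncTheta_mul_lower_bound {s : ℝ} (hs : 0 < s) (N : ℕ) {x : ℝ} (y : ℝ)
    (hx : Real.sin (Real.pi * x) ≠ 0) :
    (if 2 < s then 1 / 4 else 0) -
        6 * (1 / |Real.sin (Real.pi * x)|) *
          ∑' n : ℕ, Real.exp (-(s * (((n + N : ℕ) : ℝ) + 1) ^ 2)) -
        2 * (1 / |Real.sin (Real.pi * x)|) * (2 * N + 1) * Real.exp (-(s * (N : ℝ) ^ 2)) ≤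
      truncTheta N s x * truncTheta N s y := by
  have h1 := abs_fullTheta_sub_truncTheta_le hs N hx
  have h2 := abs_fullTheta_sub_truncTheta_le_tsum hs N y
  have h3 := abs_fullTheta_le hs hx
  have h4 := abs_truncTheta_le hs.le N y
  set B := 1 / |Real.sin (Real.pi * x)|
  have hB : 0 ≤ B := by positivity
  have hmain : (if 2 < s then (1 / 4 : ℝ) else 0) ≤ fullTheta s x * fullTheta s y := by
    split_ifs with h
    · have := half_le_fullTheta h.le x
      have := half_le_fullTheta h.le y
      nlinarith
    · exact mul_nonneg (fullTheta_nonneg hs x) (fullTheta_nonneg hs y)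
  have e1 : |fullTheta s x * (fullTheta s y - truncTheta N s y)| ≤ _ :=
    (abs_mul _ _).le.trans (mul_le_mul h3 h2 (abs_nonneg _) (by positivity))
  have e2 : |(fullTheta s x - truncTheta N s x) * truncTheta N s y| ≤ _ :=
    (abs_mul _ _).le.trans (mul_le_mul h1 h4 (abs_nonneg _) (by positivity))
  have f1 := (abs_le.mp e1).2
  have f2 := (abs_le.mp e2).2
  nlinarith

/-- Pointwise lower bound for a truncated theta series. -/
lemma truncTheta_lower_bound {s : ℝ} (hs : 0 < s) (N : ℕ) (x : ℝ) :
    (if 2 < s then 1 / 4 else 0) -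
        2 * ∑' n : ℕ, Real.exp (-(s * (((n + N : ℕ) : ℝ) + 1) ^ 2)) ≤ truncTheta N s x := by
  have h2 := (abs_le.mp (abs_fullTheta_sub_truncTheta_le_tsum hs N x)).2
  have hmain : (if 2 < s then (1 / 4 : ℝ) else 0) ≤ fullTheta s x := by
    split_ifs with h
    · have := half_le_fullTheta h.le x
      linarith
    · exact fullTheta_nonneg hs x
  linarith

lemma integrableOn_exp_neg_mul_Ioi_zero {A : ℝ} (hA : 0 < A) :
    IntegrableOn (fun t : ℝ => Real.exp (-(A * t))) (Set.Ioi 0) := by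
  simpa using integrableOn_exp_mul_Ioi (neg_lt_zero.mpr hA) 0

lemma integral_exp_neg_mul_Ioi_zero {A : ℝ} (hA : 0 < A) :
    ∫ t in Set.Ioi (0 : ℝ), Real.exp (-(A * t)) = A⁻¹ := by
  simpa [neg_div_neg_eq] using integral_exp_mul_Ioi (neg_lt_zero.mpr hA) 0

lemma truncTheta_eq_sum_Icc (N : ℕ) (s x : ℝ) :
    (truncTheta N s x : ℂ) = ∑ j ∈ Finset.Icc (-(N : ℤ)) (N : ℤ),
      (Real.exp (-(s * (j : ℝ) ^ 2)) : ℂ) *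
        Complex.exp (2 * Real.pi * Complex.I * ((j : ℝ) * x : ℝ)) := by
  induction N with
  | zero => simp [truncTheta]
  | succ N ih =>
    have hI : Finset.Icc (-((N + 1 : ℕ) : ℤ)) ((N + 1 : ℕ) : ℤ) =
        insert ((N : ℤ) + 1) (insert (-((N : ℤ) + 1)) (Finset.Icc (-(N : ℤ)) (N : ℤ))) := by
      ext j
      simp only [Finset.mem_Icc, Finset.mem_insert]
      push_cast
      omega
    rw [hI, Finset.sum_insert (by simp; omega), Finset.sum_insert (by simp), ← ih,
      truncTheta, Finset.sum_range_succ, ← add_assoc, ← truncTheta]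
    have hc : ((2 * Real.cos (2 * Real.pi * x * (N + 1)) : ℝ) : ℂ) =
        Complex.exp (2 * Real.pi * Complex.I * (((((N : ℤ) + 1 : ℤ)) : ℝ) * x : ℝ)) +
        Complex.exp (2 * Real.pi * Complex.I * ((((-((N : ℤ) + 1) : ℤ)) : ℝ) * x : ℝ)) := by
      push_cast
      rw [Complex.cos, mul_div_cancel₀ _ two_ne_zero]
      congr 2 <;> ring
    rw [Complex.ofReal_add, Complex.ofReal_mul, hc]
    push_cast
    ring_nf

lemma torusChar_eq_prod (d : ℕ) (k : Fin d → ℤ) (x : Fin d → ℝ) :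
    torusChar d k x =
      ∏ i, Complex.exp (2 * Real.pi * Complex.I * ((k i : ℝ) * x i : ℝ)) := by
  rw [torusChar, ← Complex.exp_sum, ← Finset.mul_sum]
  push_cast
  rfl

lemma exp_neg_mul_prod_truncTheta (d : ℕ) (c : ℝ) (N : ℕ) (x : Fin d → ℝ) (t : ℝ) :
    ((Real.exp (-t) * ∏ i, truncTheta N (c * t) (x i) : ℝ) : ℂ) =
      ∑ k ∈ Fintype.piFinset (fun _ : Fin d => Finset.Icc (-(N : ℤ)) (N : ℤ)),
        (Real.exp (-((1 + c * ∑ i, (k i : ℝ) ^ 2) * t)) : ℂ) * torusChar d k x := by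
  rw [Complex.ofReal_mul, Complex.ofReal_prod]
  simp_rw [truncTheta_eq_sum_Icc]
  rw [Finset.prod_univ_sum, Finset.mul_sum]
  refine Finset.sum_congr rfl fun k _ => ?_
  rw [Finset.prod_mul_distrib, ← torusChar_eq_prod, ← mul_assoc, ← Complex.ofReal_prod,
    ← Complex.ofReal_mul, ← Real.exp_sum, ← Real.exp_add]
  congr 3
  rw [Finset.sum_neg_distrib, ← Finset.mul_sum]
  ring

/-- The kernel as a Laplace average of products of one-dimensional truncated theta series. -/
lemma KNbeta_eq_integral (d : ℕ) {β : ℝ} (hβ : 0 ≤ β) (N : ℕ) (x : Fin d → ℝ) :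
    IntegrableOn (fun t : ℝ => Real.exp (-t) *
      ∏ i, truncTheta N (4 * Real.pi ^ 2 * β * t) (x i)) (Set.Ioi 0) ∧
    KNbeta d β N x = ((∫ t in Set.Ioi (0 : ℝ), Real.exp (-t) *
      ∏ i, truncTheta N (4 * Real.pi ^ 2 * β * t) (x i) : ℝ) : ℂ) := by
  have hpos : ∀ k : Fin d → ℤ, 0 < 1 + 4 * Real.pi ^ 2 * β * ∑ i, (k i : ℝ) ^ 2 :=
    fun k => by positivity
  have hInt : ∀ k : Fin d → ℤ, IntegrableOn (fun t : ℝ =>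
      (Real.exp (-((1 + 4 * Real.pi ^ 2 * β * ∑ i, (k i : ℝ) ^ 2) * t)) : ℂ) *
        torusChar d k x) (Set.Ioi 0) := fun k =>
    (integrableOn_exp_neg_mul_Ioi_zero (hpos k)).ofReal.mul_const _
  constructor
  · have h : IntegrableOn (fun t : ℝ => ((Real.exp (-t) *
        ∏ i, truncTheta N (4 * Real.pi ^ 2 * β * t) (x i) : ℝ) : ℂ)) (Set.Ioi 0) := by
      simp_rw [exp_neg_mul_prod_truncTheta]
      exact integrable_finsetSum _ fun k _ => hInt k
    exact h.re
  · rw [← integral_complex_ofReal]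
    simp_rw [exp_neg_mul_prod_truncTheta]
    rw [integral_finsetSum _ fun k _ => hInt k, KNbeta]
    refine Finset.sum_congr rfl fun k _ => ?_
    rw [integral_mul_const, integral_complex_ofReal, integral_exp_neg_mul_Ioi_zero (hpos k)]

lemma integrableOn_tail_and_integral_le {c : ℝ} (hc : 0 < c) (N : ℕ) :
    IntegrableOn (fun t : ℝ => Real.exp (-t) *
      ∑' n : ℕ, Real.exp (-(c * t * (((n + N : ℕ) : ℝ) + 1) ^ 2))) (Set.Ioi 0) ∧
    ∫ t in Set.Ioi (0 : ℝ), Real.exp (-t) *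
      ∑' n : ℕ, Real.exp (-(c * t * (((n + N : ℕ) : ℝ) + 1) ^ 2)) ≤ 2 / (c * (N + 1)) := by
  have heq : (fun t : ℝ => Real.exp (-t) *
      ∑' n : ℕ, Real.exp (-(c * t * (((n + N : ℕ) : ℝ) + 1) ^ 2))) =
      fun t => ∑' n : ℕ, Real.exp (-((1 + c * (((n + N : ℕ) : ℝ) + 1) ^ 2) * t)) := by
    ext t
    rw [← tsum_mul_left]
    refine tsum_congr fun n => ?_
    rw [← Real.exp_add]
    ring_nf
  have hpos : ∀ n : ℕ, 0 < 1 + c * (((n + N : ℕ) : ℝ) + 1) ^ 2 := fun n => by positivity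
  have hpart : ∀ L : ℕ, ∑ n ∈ Finset.range L, (1 + c * (((n + N : ℕ) : ℝ) + 1) ^ 2)⁻¹ ≤
      2 / (c * (N + 1)) := by
    intro L
    have h1 : ∑ n ∈ Finset.range L, (1 + c * (((n + N : ℕ) : ℝ) + 1) ^ 2)⁻¹ ≤
        c⁻¹ * ∑ i ∈ Finset.Ioo N (N + 1 + L), ((i : ℝ) ^ 2)⁻¹ := by
      have h2 : Finset.Ioo N (N + 1 + L) = Finset.Ico (N + 1) (N + 1 + L) := by
        ext i; simp
      rw [h2, Finset.sum_Ico_eq_sum_range, add_tsub_cancel_left, Finset.mul_sum]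
      refine Finset.sum_le_sum fun n _ => ?_
      rw [← mul_inv]
      have : (((N + 1 + n : ℕ) : ℝ)) = ((n + N : ℕ) : ℝ) + 1 := by push_cast; ring
      rw [this]
      gcongr
      linarith
    refine h1.trans ?_
    calc _ ≤ c⁻¹ * (2 / ((N : ℝ) + 1)) := by gcongr; exact sum_Ioo_inv_sq_le N _
      _ = _ := by field_simp
  have hnorm : (fun n : ℕ => ∫ t in Set.Ioi (0 : ℝ),
      ‖Real.exp (-((1 + c * (((n + N : ℕ) : ℝ) + 1) ^ 2) * t))‖) =
      fun n : ℕ => (1 + c * (((n + N : ℕ) : ℝ) + 1) ^ 2)⁻¹ := by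
    ext n
    simp_rw [Real.norm_of_nonneg (Real.exp_pos _).le]
    exact integral_exp_neg_mul_Ioi_zero (hpos n)
  have hsum : Summable fun n : ℕ => (1 + c * (((n + N : ℕ) : ℝ) + 1) ^ 2)⁻¹ :=
    summable_of_sum_range_le (fun n => (inv_pos.mpr (hpos n)).le) hpart
  have h := hasSum_integral_of_summable_integral_norm
    (fun n : ℕ => integrableOn_exp_neg_mul_Ioi_zero (hpos n)) (hnorm ▸ hsum)
  simp_rw [fun n : ℕ => integral_exp_neg_mul_Ioi_zero (hpos n)] at h
  rw [heq]
  constructor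
  · refine Integrable.of_integral_ne_zero ?_
    rw [← h.tsum_eq]
    exact (hsum.tsum_pos (fun n => (inv_pos.mpr (hpos n)).le) 0 (inv_pos.mpr (hpos 0))).ne'
  · rw [← h.tsum_eq]
    exact Real.tsum_le_of_sum_range_le (fun n => (inv_pos.mpr (hpos n)).le) hpart

lemma integrableOn_step_and_integral_eq {c : ℝ} (hc : 0 < c) :
    IntegrableOn (fun t : ℝ => Real.exp (-t) * if 2 < c * t then (1 / 4 : ℝ) else 0)
      (Set.Ioi 0) ∧
    ∫ t in Set.Ioi (0 : ℝ), Real.exp (-t) * (if 2 < c * t then (1 / 4 : ℝ) else 0) =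
      Real.exp (-(2 / c)) / 4 := by
  have heq : (fun t : ℝ => Real.exp (-t) * if 2 < c * t then (1 / 4 : ℝ) else 0) =
      (Set.Ioi (2 / c)).indicator fun t => Real.exp (-t) * (1 / 4) := by
    ext t
    simp [Set.indicator_apply, div_lt_iff₀' hc]
  have hsub : Set.Ioi (0 : ℝ) ∩ Set.Ioi (2 / c) = Set.Ioi (2 / c) :=
    Set.inter_eq_right.mpr (Set.Ioi_subset_Ioi (by positivity))
  rw [heq]
  constructor
  · rw [IntegrableOn, integrable_indicator_iff measurableSet_Ioi, IntegrableOn,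
      Measure.restrict_restrict measurableSet_Ioi, Set.inter_comm, hsub]
    exact (integrableOn_exp_neg_Ioi _).mul_const _
  · rw [setIntegral_indicator measurableSet_Ioi, hsub, integral_mul_const, integral_exp_neg_Ioi]
    ring

lemma KNbeta_one_lower_bound {β : ℝ} (hβ : 0 < β) (N : ℕ) (x : Fin 1 → ℝ) :
    Real.exp (-(2 / (4 * Real.pi ^ 2 * β))) / 4 - 4 / (4 * Real.pi ^ 2 * β * (N + 1)) ≤
      (KNbeta 1 β N x).re := by
  obtain ⟨hK, hKeq⟩ := KNbeta_eq_integral 1 hβ.le N x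
  rw [hKeq, Complex.ofReal_re]
  have hc : 0 < 4 * Real.pi ^ 2 * β := by positivity
  set c := 4 * Real.pi ^ 2 * β
  obtain ⟨h1, h1'⟩ := integrableOn_step_and_integral_eq hc
  obtain ⟨h2, h2'⟩ := integrableOn_tail_and_integral_le hc N
  have hle := setIntegral_mono_on (h1.sub (h2.const_mul 2)) hK measurableSet_Ioi fun t ht => by
    have := mul_le_mul_of_nonneg_left
      (truncTheta_lower_bound (mul_pos hc ht) N (x 0)) (Real.exp_pos (-t)).le
    simp only [Finset.univ_unique, Fin.default_eq_zero, Finset.prod_singleton, Pi.sub_apply]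
    linarith
  simp only [Pi.sub_apply] at hle
  rw [integral_sub h1 (h2.const_mul 2), h1', integral_const_mul] at hle
  have e : 4 / (c * (N + 1)) = 2 * (2 / (c * ((N : ℝ) + 1))) := by ring
  linarith

lemma KNbeta_two_lower_bound {β : ℝ} (hβ : 0 < β) {N : ℕ} (hN : 1 ≤ N) (x : Fin 2 → ℝ)
    (j : Fin 2) (hj : Real.sin (Real.pi * x j) ≠ 0) :
    Real.exp (-(2 / (4 * Real.pi ^ 2 * β))) / 4 -
      18 * (1 / |Real.sin (Real.pi * x j)|) / (4 * Real.pi ^ 2 * β * N) ≤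
      (KNbeta 2 β N x).re := by
  obtain ⟨hK, hKeq⟩ := KNbeta_eq_integral 2 hβ.le N x
  rw [hKeq, Complex.ofReal_re]
  have hc : 0 < 4 * Real.pi ^ 2 * β := by positivity
  set c := 4 * Real.pi ^ 2 * β
  have hprod : ∃ y : ℝ, ∀ t : ℝ, ∏ i, truncTheta N (c * t) (x i) =
      truncTheta N (c * t) (x j) * truncTheta N (c * t) y := by
    fin_cases j
    · exact ⟨x 1, fun t => Fin.prod_univ_two _⟩
    · exact ⟨x 0, fun t => (Fin.prod_univ_two _).trans (mul_comm _ _)⟩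
  obtain ⟨y, hy⟩ := hprod
  obtain ⟨h1, h1'⟩ := integrableOn_step_and_integral_eq hc
  obtain ⟨h2, h2'⟩ := integrableOn_tail_and_integral_le hc N
  have hA : 0 < 1 + c * (N : ℝ) ^ 2 := by positivity
  have h3 := integrableOn_exp_neg_mul_Ioi_zero hA
  have h3' := integral_exp_neg_mul_Ioi_zero hA
  have hpt := fun t (ht : t ∈ Set.Ioi (0 : ℝ)) => mul_le_mul_of_nonneg_left
      (truncTheta_mul_lower_bound (mul_pos hc ht) N y hj) (Real.exp_pos (-t)).le
  have hB0 : 0 ≤ 1 / |Real.sin (Real.pi * x j)| := by positivity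
  set B := 1 / |Real.sin (Real.pi * x j)|
  have hle := setIntegral_mono_on ((h1.sub (h2.const_mul (6 * B))).sub
      (h3.const_mul (2 * B * (2 * N + 1)))) hK measurableSet_Ioi fun t ht => by
    have h := hpt t ht
    have e : Real.exp (-((1 + c * (N : ℝ) ^ 2) * t)) =
        Real.exp (-t) * Real.exp (-(c * t * (N : ℝ) ^ 2)) := by
      rw [← Real.exp_add]; ring_nf
    simp only [Pi.sub_apply, hy, e]
    linarith
  rw [integral_sub' (h1.sub (h2.const_mul (6 * B))) (h3.const_mul _),
    integral_sub' h1 (h2.const_mul (6 * B)), h1', integral_const_mul, integral_const_mul, h3'] at hle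
  have hN' : (1 : ℝ) ≤ N := by exact_mod_cast hN
  have e1 : 6 * B * (∫ t in Set.Ioi (0 : ℝ), Real.exp (-t) *
      ∑' n : ℕ, Real.exp (-(c * t * (((n + N : ℕ) : ℝ) + 1) ^ 2))) ≤ 6 * B * (2 / (c * N)) := by
    refine mul_le_mul_of_nonneg_left (h2'.trans ?_) (by positivity)
    gcongr
    linarith
  have e2 : 2 * B * (2 * N + 1) * (1 + c * (N : ℝ) ^ 2)⁻¹ ≤ 2 * B * (3 * N) * (c * N ^ 2)⁻¹ := by
    gcongr
    · linarith
    · linarith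
  have e3 : 6 * B * (2 / (c * N)) + 2 * B * (3 * N) * (c * N ^ 2)⁻¹ = 18 * B / (c * N) := by
    field_simp
    ring
  linarith

/-- The index set `|k|_∞ ≤ N` of the square truncation. -/
def freqBox (d N : ℕ) : Finset (Fin d → ℤ) :=
  Fintype.piFinset fun _ : Fin d => Finset.Icc (-(N : ℤ)) (N : ℤ)

lemma mem_freqBox {d N : ℕ} {k : Fin d → ℤ} : k ∈ freqBox d N ↔ ∀ i, |k i| ≤ N := by
  simp [freqBox, abs_le]

lemma freqBox_mono (d : ℕ) : Monotone (freqBox d) := fun _ _ h _ hk =>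
  mem_freqBox.mpr fun i => (mem_freqBox.mp hk i).trans (by exact_mod_cast h)

lemma card_freqBox (d N : ℕ) : (freqBox d N).card = (2 * N + 1) ^ d := by
  rw [freqBox, Fintype.card_piFinset]
  simp only [Int.card_Icc, Finset.prod_const, Finset.card_univ, Fintype.card_fin]
  congr 1
  omega

lemma re_KNbeta (d : ℕ) (β : ℝ) (N : ℕ) (x : Fin d → ℝ) :
    (KNbeta d β N x).re = ∑ k ∈ freqBox d N,
      (1 + 4 * Real.pi ^ 2 * β * ∑ i, (k i : ℝ) ^ 2)⁻¹ *
        Real.cos (2 * Real.pi * ∑ i, (k i : ℝ) * x i) := by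
  rw [KNbeta, Complex.re_sum, freqBox]
  refine Finset.sum_congr rfl fun k _ => ?_
  rw [Complex.re_ofReal_mul, torusChar]
  congr 1
  rw [← Complex.exp_ofReal_mul_I_re]
  congr 2
  push_cast
  ring

/-- In dimension two the resolvent weights are not summable: their box sums diverge. -/
lemma exists_forall_le_sum_freqBox_two {c : ℝ} (hc : 0 < c) (C : ℝ) :
    ∃ M₀ : ℕ, ∀ M, M₀ ≤ M →
      C ≤ ∑ k ∈ freqBox 2 M, (1 + c * ∑ i, (k i : ℝ) ^ 2)⁻¹ := by
  have hw : ∀ k : Fin 2 → ℤ, 0 ≤ (1 + c * ∑ i, (k i : ℝ) ^ 2)⁻¹ := fun k => by positivity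
  have hdouble : ∀ M : ℕ, 1 ≤ M →
      (∑ k ∈ freqBox 2 M, (1 + c * ∑ i, (k i : ℝ) ^ 2)⁻¹) + 12 / (1 + 8 * c) ≤
        ∑ k ∈ freqBox 2 (2 * M), (1 + c * ∑ i, (k i : ℝ) ^ 2)⁻¹ := by
    intro M hM
    have hM' : (1 : ℝ) ≤ M := by exact_mod_cast hM
    have hsub := freqBox_mono 2 (show M ≤ 2 * M by omega)
    rw [← Finset.sum_sdiff hsub, add_comm]
    gcongr
    have hcard : 12 * (M : ℝ) ^ 2 ≤ ((freqBox 2 (2 * M) \ freqBox 2 M).card : ℝ) := by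
      rw [Finset.card_sdiff_of_subset hsub,
        Nat.cast_sub (Finset.card_le_card hsub), card_freqBox, card_freqBox]
      push_cast
      nlinarith
    have hterm : ∀ k ∈ freqBox 2 (2 * M) \ freqBox 2 M,
        (1 + 8 * c * (M : ℝ) ^ 2)⁻¹ ≤ (1 + c * ∑ i, (k i : ℝ) ^ 2)⁻¹ := by
      intro k hk
      have hk' := mem_freqBox.mp (Finset.mem_sdiff.mp hk).1
      have hsq : ∀ i, (k i : ℝ) ^ 2 ≤ 4 * (M : ℝ) ^ 2 := fun i => by
        have h : |(k i : ℝ)| ≤ 2 * M := by exact_mod_cast hk' i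
        rw [← sq_abs]
        nlinarith [abs_nonneg (k i : ℝ)]
      refine inv_anti₀ (by positivity) ?_
      rw [Fin.sum_univ_two]
      nlinarith [mul_le_mul_of_nonneg_left (hsq 0) hc.le, mul_le_mul_of_nonneg_left (hsq 1) hc.le]
    calc 12 / (1 + 8 * c) ≤ 12 * (M : ℝ) ^ 2 * (1 + 8 * c * (M : ℝ) ^ 2)⁻¹ := by
          rw [← div_eq_mul_inv, div_le_div_iff₀ (by positivity) (by positivity)]
          nlinarith
      _ ≤ ((freqBox 2 (2 * M) \ freqBox 2 M).card : ℝ) * (1 + 8 * c * (M : ℝ) ^ 2)⁻¹ := by gcongr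
      _ ≤ _ := by
        rw [← nsmul_eq_mul]
        exact Finset.card_nsmul_le_sum _ _ _ hterm
  have hpow : ∀ j : ℕ, j * (12 / (1 + 8 * c)) ≤
      ∑ k ∈ freqBox 2 (2 ^ j), (1 + c * ∑ i, (k i : ℝ) ^ 2)⁻¹ := by
    intro j
    induction j with
    | zero => simpa using Finset.sum_nonneg fun k _ => hw k
    | succ j ih =>
      have := hdouble (2 ^ j) Nat.one_le_two_pow
      rw [pow_succ']
      push_cast
      linarith
  obtain ⟨j, hj⟩ := exists_nat_ge (C / (12 / (1 + 8 * c)))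
  refine ⟨2 ^ j, fun M hM => ?_⟩
  rw [div_le_iff₀ (by positivity)] at hj
  exact (hj.trans (hpow j)).trans
    (Finset.sum_le_sum_of_subset_of_nonneg (freqBox_mono 2 hM) fun k _ _ => hw k)

lemma two_mul_abs_sub_round_le_abs_sin (x : ℝ) : 2 * |x - round x| ≤ |Real.sin (Real.pi * x)| := by
  have h1 : |Real.pi * (x - round x)| ≤ Real.pi / 2 := by
    rw [abs_mul, abs_of_pos Real.pi_pos]
    have := abs_sub_round x
    nlinarith [Real.pi_pos]
  have h2 := Real.mul_abs_le_abs_sin h1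
  have h3 : |Real.sin (Real.pi * (x - round x))| = |Real.sin (Real.pi * x)| := by
    rw [mul_sub, mul_comm Real.pi (round x : ℝ), Real.sin_sub_int_mul_pi]
    simp [abs_mul, abs_zpow]
  rw [h3, abs_mul, abs_of_pos Real.pi_pos] at h2
  calc _ = 2 / Real.pi * (Real.pi * |x - round x|) := by field_simp
    _ ≤ _ := h2

lemma cos_two_pi_sum_mul_round {d : ℕ} (k : Fin d → ℤ) (x : Fin d → ℝ) :
    Real.cos (2 * Real.pi * ∑ i, (k i : ℝ) * x i) =
      Real.cos (2 * Real.pi * ∑ i, (k i : ℝ) * (x i - round (x i))) := by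
  rw [← Real.cos_sub_int_mul_two_pi _ (∑ i, k i * round (x i))]
  congr 1
  simp_rw [mul_sub, Finset.sum_sub_distrib]
  push_cast
  ring

lemma KNbeta_two_lower_bound_near {β R : ℝ} (hβ : 0 < β) (hR : 0 < R) {q M N : ℕ}
    (hq : 7 * R ≤ q) (hM : 1 ≤ M) (hMN : M * q ≤ N) (hNM : N ≤ 2 * M * q) (x : Fin 2 → ℝ)
    (hx : ∀ j, |Real.sin (Real.pi * x j)| ≤ R / N) :
    (∑ k ∈ freqBox 2 M, (1 + 4 * Real.pi ^ 2 * β * ∑ i, (k i : ℝ) ^ 2)⁻¹) / 2 -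
      36 * q ^ 2 / (4 * Real.pi ^ 2 * β) ≤ (KNbeta 2 β N x).re := by
  rw [re_KNbeta]
  have hc : 0 < 4 * Real.pi ^ 2 * β := by positivity
  set c := 4 * Real.pi ^ 2 * β
  have hw : ∀ k : Fin 2 → ℤ, 0 ≤ (1 + c * ∑ i, (k i : ℝ) ^ 2)⁻¹ := fun k => by positivity
  have hq0 : (0 : ℝ) < q := by linarith
  have hq1 : 1 ≤ q := by exact_mod_cast hq0
  have hMle : M ≤ N := (Nat.le_mul_of_pos_right M hq1).trans hMN
  have hM' : (1 : ℝ) ≤ M := by exact_mod_cast hM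
  have hN1 : (1 : ℝ) ≤ N := by exact_mod_cast hM.trans hMle
  have hMN' : (M : ℝ) * q ≤ N := by exact_mod_cast hMN
  have hNM' : (N : ℝ) ≤ 2 * M * q := by exact_mod_cast hNM
  have hsub := freqBox_mono 2 hMle
  have hlow : (∑ k ∈ freqBox 2 M, (1 + c * ∑ i, (k i : ℝ) ^ 2)⁻¹) / 2 ≤
      ∑ k ∈ freqBox 2 M, (1 + c * ∑ i, (k i : ℝ) ^ 2)⁻¹ *
        Real.cos (2 * Real.pi * ∑ i, (k i : ℝ) * x i) := by
    rw [Finset.sum_div]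
    refine Finset.sum_le_sum fun k hk => ?_
    rw [div_eq_mul_one_div]
    refine mul_le_mul_of_nonneg_left ?_ (hw k)
    rw [cos_two_pi_sum_mul_round]
    have hterm : ∀ i, |(k i : ℝ) * (x i - round (x i))| ≤ 1 / 14 := fun i => by
      have h1 : |(k i : ℝ)| ≤ M := by exact_mod_cast mem_freqBox.mp hk i
      have h2 : |x i - round (x i)| ≤ R / N / 2 := by
        have := two_mul_abs_sub_round_le_abs_sin (x i)
        have := hx i
        linarith
      rw [abs_mul]
      refine (mul_le_mul h1 h2 (abs_nonneg _) (by positivity)).trans ?_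
      have h3 : M * (R / N / 2) = M * R / (2 * N) := by ring
      rw [h3, div_le_div_iff₀ (by positivity) (by norm_num)]
      nlinarith
    have habs : |2 * Real.pi * ∑ i, (k i : ℝ) * (x i - round (x i))| ≤ 1 := by
      rw [abs_mul, abs_of_pos Real.two_pi_pos, Fin.sum_univ_two]
      have h := abs_add_le ((k 0 : ℝ) * (x 0 - round (x 0))) ((k 1 : ℝ) * (x 1 - round (x 1)))
      have h0 := hterm 0
      have h1 := hterm 1
      have h4 := Real.pi_lt_d2
      nlinarith [Real.pi_pos]
    have hsq := (sq_le_one_iff_abs_le_one _).mpr habs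
    have := Real.one_sub_sq_div_two_le_cos
      (x := 2 * Real.pi * ∑ i, (k i : ℝ) * (x i - round (x i)))
    linarith
  have hhigh : |∑ k ∈ freqBox 2 N \ freqBox 2 M, (1 + c * ∑ i, (k i : ℝ) ^ 2)⁻¹ *
      Real.cos (2 * Real.pi * ∑ i, (k i : ℝ) * x i)| ≤ 36 * q ^ 2 / c := by
    have hterm : ∀ k ∈ freqBox 2 N \ freqBox 2 M, |(1 + c * ∑ i, (k i : ℝ) ^ 2)⁻¹ *
        Real.cos (2 * Real.pi * ∑ i, (k i : ℝ) * x i)| ≤ (c * (M : ℝ) ^ 2)⁻¹ := by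
      intro k hk
      rw [abs_mul, abs_of_nonneg (hw k)]
      refine (mul_le_of_le_one_right (hw k) (Real.abs_cos_le_one _)).trans ?_
      have hk' := (Finset.mem_sdiff.mp hk).2
      rw [mem_freqBox] at hk'
      push Not at hk'
      obtain ⟨i, hi⟩ := hk'
      have h1 : (M : ℝ) < |(k i : ℝ)| := by exact_mod_cast hi
      have h2 : (M : ℝ) ^ 2 ≤ (k i : ℝ) ^ 2 := by
        rw [← sq_abs (k i : ℝ)]
        gcongr
      have h3 : (k i : ℝ) ^ 2 ≤ ∑ i, (k i : ℝ) ^ 2 :=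
        Finset.single_le_sum (f := fun i => (k i : ℝ) ^ 2) (fun _ _ => sq_nonneg _)
          (Finset.mem_univ i)
      refine inv_anti₀ (by positivity) ?_
      have := mul_le_mul_of_nonneg_left (h2.trans h3) hc.le
      linarith
    have hcard : ((freqBox 2 N \ freqBox 2 M).card : ℝ) ≤ 36 * q ^ 2 * M ^ 2 := by
      have h1 : (freqBox 2 N \ freqBox 2 M).card ≤ (2 * N + 1) ^ 2 := by
        rw [← card_freqBox]
        exact Finset.card_le_card Finset.sdiff_subset
      have h2 : ((freqBox 2 N \ freqBox 2 M).card : ℝ) ≤ (2 * (N : ℝ) + 1) ^ 2 := by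
        exact_mod_cast h1
      have h3 : 2 * (N : ℝ) + 1 ≤ 6 * (M * q) := by linarith
      calc _ ≤ _ := h2
        _ ≤ (6 * ((M : ℝ) * q)) ^ 2 := by gcongr
        _ = _ := by ring
    refine (Finset.abs_sum_le_sum_abs _ _).trans ?_
    refine (Finset.sum_le_card_nsmul _ _ _ hterm).trans ?_
    rw [nsmul_eq_mul]
    calc _ ≤ 36 * (q : ℝ) ^ 2 * M ^ 2 * (c * (M : ℝ) ^ 2)⁻¹ := by gcongr
      _ = _ := by field_simp
  rw [← Finset.sum_sdiff hsub]
  have := (abs_le.mp hhigh).1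
  linarith

lemma im_KNbeta (d : ℕ) {β : ℝ} (hβ : 0 ≤ β) (N : ℕ) (x : Fin d → ℝ) :
    (KNbeta d β N x).im = 0 := by
  rw [(KNbeta_eq_integral d hβ N x).2, Complex.ofReal_im]

lemma exists_forall_re_KNbeta_one_pos {β : ℝ} (hβ : 0 < β) :
    ∃ N₀ : ℕ, ∀ N : ℕ, N₀ ≤ N → ∀ x : Fin 1 → ℝ, 0 < (KNbeta 1 β N x).re := by
  have hc : 0 < 4 * Real.pi ^ 2 * β := by positivity
  have hlow := fun N x => KNbeta_one_lower_bound hβ N x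
  set c := 4 * Real.pi ^ 2 * β
  set E := Real.exp (-(2 / c)) with hE
  have hE0 : 0 < E := Real.exp_pos _
  obtain ⟨N₀, hN₀⟩ := exists_nat_ge (16 / (c * E))
  refine ⟨N₀, fun N hN x => lt_of_lt_of_le ?_ (hlow N x)⟩
  have h1 : (N₀ : ℝ) ≤ N := by exact_mod_cast hN
  have h2 := hN₀.trans h1
  rw [div_le_iff₀ (by positivity)] at h2
  rw [sub_pos, div_lt_div_iff₀ (by positivity) (by norm_num)]
  nlinarith [mul_pos hc hE0]

lemma exists_forall_re_KNbeta_two_pos {β : ℝ} (hβ : 0 < β) :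
    ∃ N₀ : ℕ, ∀ N : ℕ, N₀ ≤ N → ∀ x : Fin 2 → ℝ, 0 < (KNbeta 2 β N x).re := by
  have hc : 0 < 4 * Real.pi ^ 2 * β := by positivity
  have hE0 : 0 < Real.exp (-(2 / (4 * Real.pi ^ 2 * β))) := Real.exp_pos _
  set c := 4 * Real.pi ^ 2 * β with hc_def
  set E := Real.exp (-(2 / c)) with hE
  set R := 72 / (c * E) with hR_def
  have hR : 0 < R := by positivity
  obtain ⟨q, hq⟩ := exists_nat_ge (7 * R)
  have hq0 : 0 < q := by
    have : (0 : ℝ) < q := by linarith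
    exact_mod_cast this
  obtain ⟨M₀, hM₀⟩ := exists_forall_le_sum_freqBox_two hc (2 * (36 * q ^ 2 / c) + 1)
  refine ⟨(M₀ + 1) * q, fun N hN x => ?_⟩
  have hMge : M₀ + 1 ≤ N / q := (Nat.le_div_iff_mul_le hq0).mpr hN
  have hMN : N / q * q ≤ N := Nat.div_mul_le_self N q
  have hN1 : 1 ≤ N := le_trans (Nat.mul_pos (Nat.succ_pos _) hq0) hN
  have hN' : (0 : ℝ) < N := by exact_mod_cast hN1
  have hNM : N ≤ 2 * (N / q) * q := by
    have h1 := Nat.lt_div_mul_add hq0 (a := N)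
    have h2 : q ≤ N / q * q := Nat.le_mul_of_pos_left q (by omega)
    rw [mul_assoc]
    omega
  by_cases hx : ∀ j, |Real.sin (Real.pi * x j)| ≤ R / N
  · have h := KNbeta_two_lower_bound_near hβ hR hq (by omega) hMN hNM x hx
    rw [← hc_def] at h
    have := hM₀ (N / q) (by omega)
    linarith
  · push Not at hx
    obtain ⟨j, hj⟩ := hx
    have hs : 0 < |Real.sin (Real.pi * x j)| := (by positivity : 0 < R / N).trans hj
    refine lt_of_lt_of_le ?_ (KNbeta_two_lower_bound hβ hN1 x j (abs_pos.mp hs))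
    rw [← hc_def, ← hE, sub_pos]
    rw [div_lt_iff₀ hN', hR_def, div_lt_iff₀ (by positivity)] at hj
    rw [mul_one_div, div_div, div_lt_div_iff₀ (by positivity) (by norm_num)]
    linarith

lemma volume_restrict_torusBox (d : ℕ) :
    (volume.restrict (torusBox d) : Measure (Fin d → ℝ)) =
      Measure.pi fun _ => volume.restrict (Set.Ico (0 : ℝ) 1) :=
  Measure.restrict_pi_pi _ _

instance isFiniteMeasure_restrict_torusBox (d : ℕ) :
    IsFiniteMeasure (volume.restrict (torusBox d) : Measure (Fin d → ℝ)) := by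
  rw [volume_restrict_torusBox]
  infer_instance

lemma integral_Ico_exp_two_pi_int (m : ℤ) :
    ∫ y in Set.Ico (0 : ℝ) 1, Complex.exp (2 * Real.pi * Complex.I * ((m : ℝ) * y : ℝ)) =
      if m = 0 then 1 else 0 := by
  split_ifs with hm
  · simp [hm]
  · rw [integral_Ico_eq_integral_Ioc, ← intervalIntegral.integral_of_le zero_le_one]
    have hne : 2 * Real.pi * Complex.I * (m : ℂ) ≠ 0 :=
      mul_ne_zero Complex.two_pi_I_ne_zero (Int.cast_ne_zero.mpr hm)
    have h := integral_exp_mul_complex (a := 0) (b := 1) hne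
    push_cast at h ⊢
    simp_rw [← mul_assoc]
    rw [h, mul_one, mul_zero, Complex.exp_zero, mul_comm, Complex.exp_int_mul_two_pi_mul_I,
      sub_self, zero_div]

lemma integral_torusChar (d : ℕ) (k : Fin d → ℤ) :
    ∫ x in torusBox d, torusChar d k x = if k = 0 then 1 else 0 := by
  simp_rw [torusChar_eq_prod]
  rw [volume_restrict_torusBox, integral_fintype_prod_eq_prod
    (fun i y => Complex.exp (2 * Real.pi * Complex.I * ((k i : ℝ) * y : ℝ)))]
  simp_rw [integral_Ico_exp_two_pi_int]
  rw [Finset.prod_ite_zero]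
  simp [funext_iff]

lemma continuous_torusChar (d : ℕ) (k : Fin d → ℤ) : Continuous (torusChar d k) := by
  unfold torusChar
  fun_prop

lemma norm_torusChar (d : ℕ) (k : Fin d → ℤ) (x : Fin d → ℝ) : ‖torusChar d k x‖ = 1 := by
  have h : torusChar d k x =
      Complex.exp ((2 * Real.pi * ∑ i, (k i : ℝ) * x i : ℝ) * Complex.I) := by
    rw [torusChar]
    congr 1
    push_cast
    ring
  rw [h, Complex.norm_exp_ofReal_mul_I]

lemma torusChar_sub (d : ℕ) (k : Fin d → ℤ) (x y : Fin d → ℝ) :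
    torusChar d k (x - y) = torusChar d (fun i => -(k i)) y * torusChar d k x := by
  rw [torusChar, torusChar, torusChar, ← Complex.exp_add, ← mul_add]
  congr 2
  push_cast
  rw [← Finset.sum_add_distrib]
  refine Finset.sum_congr rfl fun i _ => ?_
  rw [Pi.sub_apply]
  push_cast
  ring

lemma integrable_torusChar (d : ℕ) (k : Fin d → ℤ) :
    IntegrableOn (torusChar d k) (torusBox d) :=
  Integrable.of_bound (continuous_torusChar d k).aestronglyMeasurable 1
    (ae_of_all _ fun x => (norm_torusChar d k x).le)

/-- Every translate of the reflected kernel has unit mass. -/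
lemma integral_KNbeta_sub (d : ℕ) (β : ℝ) (N : ℕ) (x : Fin d → ℝ) :
    IntegrableOn (fun y => KNbeta d β N (x - y)) (torusBox d) ∧
    ∫ y in torusBox d, KNbeta d β N (x - y) = 1 := by
  simp only [KNbeta, torusChar_sub]
  have hInt := fun k : Fin d → ℤ => ((integrable_torusChar d fun i => -(k i)).mul_const
    (torusChar d k x)).const_mul (((1 + 4 * Real.pi ^ 2 * β * ∑ i, ((k i : ℝ)) ^ 2)⁻¹ : ℝ) : ℂ)
  refine ⟨integrable_finsetSum _ fun k _ => hInt k, ?_⟩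
  rw [integral_finsetSum _ fun k _ => hInt k, Finset.sum_eq_single 0]
  · rw [integral_const_mul, integral_mul_const, integral_torusChar]
    simp [torusChar, ← Pi.zero_def]
  · intro k _ hk
    rw [integral_const_mul, integral_mul_const, integral_torusChar, if_neg, zero_mul, mul_zero]
    exact fun h => hk (neg_eq_zero.mp h)
  · intro h
    exact absurd (Fintype.mem_piFinset.mpr fun i => by simp) h

lemma integral_KNbeta (d : ℕ) (β : ℝ) (N : ℕ) :
    ∫ x in torusBox d, KNbeta d β N x = 1 := by
  simp only [KNbeta]
  have hInt := fun k : Fin d → ℤ => (integrable_torusChar d k).const_mul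
    (((1 + 4 * Real.pi ^ 2 * β * ∑ i, ((k i : ℝ)) ^ 2)⁻¹ : ℝ) : ℂ)
  rw [integral_finsetSum _ fun k _ => hInt k, Finset.sum_eq_single 0]
  · rw [integral_const_mul, integral_torusChar]
    simp
  · intro k _ hk
    rw [integral_const_mul, integral_torusChar, if_neg hk, mul_zero]
  · intro h
    exact absurd (Fintype.mem_piFinset.mpr fun i => by simp) h

lemma TNbeta_eq_integral (d : ℕ) (β : ℝ) (N : ℕ) {f : (Fin d → ℝ) → ℂ}
    (hf : IntegrableOn f (torusBox d)) (x : Fin d → ℝ) :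
    TNbeta d β N f x = ∫ y in torusBox d, KNbeta d β N (x - y) * f y := by
  have hInt := fun k : Fin d → ℤ => ((hf.mul_bdd (c := 1)
    (continuous_torusChar d fun i => -(k i)).aestronglyMeasurable
    (ae_of_all _ fun y => (norm_torusChar d _ y).le)).const_mul
    (((1 + 4 * Real.pi ^ 2 * β * ∑ i, ((k i : ℝ)) ^ 2)⁻¹ : ℝ) : ℂ)).mul_const (torusChar d k x)
  have heq : (fun y => KNbeta d β N (x - y) * f y) = fun y =>
      ∑ k ∈ Fintype.piFinset (fun _ : Fin d => Finset.Icc (-(N : ℤ)) (N : ℤ)),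
        (((1 + 4 * Real.pi ^ 2 * β * ∑ i, ((k i : ℝ)) ^ 2)⁻¹ : ℝ) : ℂ) *
          (f y * torusChar d (fun i => -(k i)) y) * torusChar d k x := by
    ext y
    rw [KNbeta, Finset.sum_mul]
    refine Finset.sum_congr rfl fun k _ => ?_
    rw [torusChar_sub]
    ring
  rw [heq, integral_finsetSum _ fun k _ => hInt k, TNbeta]
  refine Finset.sum_congr rfl fun k _ => ?_
  rw [integral_mul_const, integral_const_mul]

/-- A nonnegative kernel of unit mass gives an `L^∞` contraction. -/
lemma norm_TNbeta_le {d : ℕ} {β : ℝ} {N : ℕ}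
    (hK : ∀ x : Fin d → ℝ, (KNbeta d β N x).im = 0 ∧ 0 < (KNbeta d β N x).re)
    {f : (Fin d → ℝ) → ℂ} (hf : Measurable f) {M : ℝ}
    (hM : ∀ᵐ x ∂(volume.restrict (torusBox d)), ‖f x‖ ≤ M) (x : Fin d → ℝ) :
    ‖TNbeta d β N f x‖ ≤ M := by
  obtain ⟨hInt, hone⟩ := integral_KNbeta_sub d β N x
  have hnorm : ∀ z, ‖KNbeta d β N z‖ = (KNbeta d β N z).re := fun z => by
    rw [← Complex.abs_re_eq_norm.mpr (hK z).1, abs_of_pos (hK z).2]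
  rw [TNbeta_eq_integral d β N (Integrable.of_bound hf.aestronglyMeasurable M hM)]
  refine (norm_integral_le_of_norm_le (hInt.re.mul_const M) ?_).trans_eq ?_
  · filter_upwards [hM] with y hy
    rw [norm_mul, hnorm]
    exact mul_le_mul_of_nonneg_left hy (hK _).2.le
  · rw [integral_mul_const, integral_re hInt, hone]
    simp

/-- Let `d ∈ {1,2}` and `β > 0`. There exists `N₀` depending only on `β, d`
such that for all `N ≥ N₀` the kernel `K_{N,β}` is strictly positive on `𝕋^d` with unit mass;
consequently `‖T_{N,β} f‖_∞ ≤ ‖f‖_∞` for every `f ∈ L^∞(𝕋^d)`. -/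
theorem statement2 (d : ℕ) (hd : d = 1 ∨ d = 2) (β : ℝ) (hβ : 0 < β) :
    ∃ N₀ : ℕ, ∀ N : ℕ, N₀ ≤ N →
      (∀ x : Fin d → ℝ, (KNbeta d β N x).im = 0 ∧ 0 < (KNbeta d β N x).re) ∧
      (∫ x in torusBox d, KNbeta d β N x) = 1 ∧
      ∀ f : (Fin d → ℝ) → ℂ, Measurable f →
        (∀ (m : Fin d → ℤ) (x : Fin d → ℝ), f (fun i => x i + (m i : ℝ)) = f x) →
        ∀ M : ℝ, (∀ᵐ x ∂(volume.restrict (torusBox d)), ‖f x‖ ≤ M) →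
          ∀ x : Fin d → ℝ, ‖TNbeta d β N f x‖ ≤ M := by
  have hpos : ∃ N₀ : ℕ, ∀ N : ℕ, N₀ ≤ N → ∀ x : Fin d → ℝ, 0 < (KNbeta d β N x).re := by
    rcases hd with rfl | rfl
    · exact exists_forall_re_KNbeta_one_pos hβ
    · exact exists_forall_re_KNbeta_two_pos hβ
  obtain ⟨N₀, hN₀⟩ := hpos
  refine ⟨N₀, fun N hN => ?_⟩
  have hK : ∀ x : Fin d → ℝ, (KNbeta d β N x).im = 0 ∧ 0 < (KNbeta d β N x).re :=
    fun x => ⟨im_KNbeta d hβ.le N x, hN₀ N hN x⟩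
  exact ⟨hK, integral_KNbeta d β N, fun f hf _ M hM x => norm_TNbeta_le hK hf hM x⟩

end
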